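/- (QR factor perturbation) Let A ∈ ℝ^{d×k} with d ≥ k have full column rank and QR factorization A = QR with Q having orthonormal columns. Let E be a perturbation with ‖E‖₂‖A†‖₂ < 1, so that A + E has full column rank with QR factorization A + E = Q̃R̃. Then ‖Q̃ − Q‖₂ ≤ √(2k) · ‖A†‖₂‖E‖₂ / (1 − ‖A†‖₂‖E‖₂). -/

import Mathlib

open Matrix Finset

/-- Spectral (operator) norm of a real matrix. -/
noncomputable def specNorm {a b : ℕ} (A : Matrix (Fin a) (Fin b) ℝ) : ℝ :=
  ‖LinearMap.toContinuousLinearMap (Matrix.toEuclideanLin A)‖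

/-- `B` is the Moore–Penrose pseudoinverse of `X`. -/
def IsMoorePenrose {a b : ℕ} (X : Matrix (Fin a) (Fin b) ℝ)
    (B : Matrix (Fin b) (Fin a) ℝ) : Prop :=
  X * B * X = X ∧ B * X * B = B ∧ (X * B)ᵀ = X * B ∧ (B * X)ᵀ = B * X

lemma specNorm_nonneg {a b : ℕ} (A : Matrix (Fin a) (Fin b) ℝ) : 0 ≤ specNorm A :=
  norm_nonneg _

lemma dotProduct_self_eq_norm_sq {n : ℕ} (v : Fin n → ℝ) :
    v ⬝ᵥ v = ‖WithLp.toLp 2 v‖ ^ 2 := by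
  simp only [EuclideanSpace.norm_sq_eq, dotProduct, Real.norm_eq_abs, sq_abs, pow_two (v _)]

lemma mulVec_dotProduct_self_le {a b : ℕ} (A : Matrix (Fin a) (Fin b) ℝ) (c : Fin b → ℝ) :
    (A *ᵥ c) ⬝ᵥ (A *ᵥ c) ≤ specNorm A ^ 2 * (c ⬝ᵥ c) := by
  rw [dotProduct_self_eq_norm_sq, dotProduct_self_eq_norm_sq, ← mul_pow]
  have h := (LinearMap.toContinuousLinearMap (Matrix.toEuclideanLin A)).le_opNorm (WithLp.toLp 2 c)
  exact pow_le_pow_left₀ (norm_nonneg _) h 2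

lemma sq_dotProduct_le {n : ℕ} (v w : Fin n → ℝ) : (v ⬝ᵥ w) ^ 2 ≤ (v ⬝ᵥ v) * (w ⬝ᵥ w) := by
  simpa [dotProduct, pow_two] using Finset.sum_mul_sq_le_sq_mul_sq univ v w

/-- The spectral norm is bounded by the Frobenius norm. -/
lemma specNorm_le_of_sum_sq_le {a b : ℕ} (A : Matrix (Fin a) (Fin b) ℝ) {C : ℝ} (hC : 0 ≤ C)
    (h : ∑ j, (Aᵀ * A) j j ≤ C ^ 2) : specNorm A ≤ C := by
  refine ContinuousLinearMap.opNorm_le_bound _ hC fun x => ?_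
  refine le_of_sq_le_sq ?_ (by positivity)
  have h1 : ‖(LinearMap.toContinuousLinearMap (Matrix.toEuclideanLin A)) x‖ ^ 2
      = (A *ᵥ x.ofLp) ⬝ᵥ (A *ᵥ x.ofLp) := (dotProduct_self_eq_norm_sq _).symm
  have h2 : ‖x‖ ^ 2 = x.ofLp ⬝ᵥ x.ofLp := (dotProduct_self_eq_norm_sq _).symm
  have h3 : ∑ i, A i ⬝ᵥ A i = ∑ j, (Aᵀ * A) j j := by
    simp only [dotProduct, Matrix.mul_apply, Matrix.transpose_apply]
    exact Finset.sum_comm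
  have hx : 0 ≤ x.ofLp ⬝ᵥ x.ofLp := h2 ▸ sq_nonneg _
  rw [mul_pow, h1, h2]
  calc (A *ᵥ x.ofLp) ⬝ᵥ (A *ᵥ x.ofLp)
      = ∑ i, (A i ⬝ᵥ x.ofLp) ^ 2 := by simp [dotProduct, Matrix.mulVec, pow_two]
    _ ≤ ∑ i, (A i ⬝ᵥ A i) * (x.ofLp ⬝ᵥ x.ofLp) := Finset.sum_le_sum fun i _ => sq_dotProduct_le _ _
    _ = (∑ j, (Aᵀ * A) j j) * (x.ofLp ⬝ᵥ x.ofLp) := by rw [← Finset.sum_mul, h3]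
    _ ≤ C ^ 2 * (x.ofLp ⬝ᵥ x.ofLp) := by gcongr

lemma mulVec_dotProduct_mulVec {d k l : ℕ} (P : Matrix (Fin d) (Fin k) ℝ)
    (Q : Matrix (Fin d) (Fin l) ℝ) (a : Fin k → ℝ) (b : Fin l → ℝ) :
    (P *ᵥ a) ⬝ᵥ (Q *ᵥ b) = a ⬝ᵥ ((Pᵀ * Q) *ᵥ b) := by
  rw [← Matrix.mulVec_mulVec, Matrix.dotProduct_mulVec a, Matrix.vecMul_transpose]

lemma mulVec_dotProduct_mulVec_of_orthonormal {d k : ℕ} {Q : Matrix (Fin d) (Fin k) ℝ}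
    (hQ : Qᵀ * Q = 1) (a b : Fin k → ℝ) : (Q *ᵥ a) ⬝ᵥ (Q *ᵥ b) = a ⬝ᵥ b := by
  rw [mulVec_dotProduct_mulVec, hQ, Matrix.one_mulVec]

/-- A vector within relative distance `y` of `u` makes an angle with sine at most `y` with `u`. -/
lemma sq_dotProduct_add_le {n : ℕ} {q u g : Fin n → ℝ} {y : ℝ} (hy0 : 0 ≤ y) (hy : y ≤ 1)
    (hq : q ⬝ᵥ q = 1) (hqu : q ⬝ᵥ u = 0) (hg : g ⬝ᵥ g ≤ y ^ 2 * (u ⬝ᵥ u)) :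
    (q ⬝ᵥ (u + g)) ^ 2 ≤ y ^ 2 * ((u + g) ⬝ᵥ (u + g)) := by
  have h := sq_dotProduct_le q (y ^ 2 • u + g)
  have hug : g ⬝ᵥ u = u ⬝ᵥ g := dotProduct_comm _ _
  simp only [dotProduct_add, add_dotProduct, dotProduct_smul, smul_dotProduct, hq, hqu,
    smul_eq_mul, hug] at h ⊢
  have h1 : 0 ≤ 1 - y ^ 2 := by nlinarith
  nlinarith [mul_nonneg h1 (sub_nonneg.2 hg)]

lemma upperTriangular_mul_apply_self {k : ℕ} {M N : Matrix (Fin k) (Fin k) ℝ}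
    (hM : M.BlockTriangular id) (hN : N.BlockTriangular id) (i : Fin k) :
    (M * N) i i = M i i * N i i := by
  rw [Matrix.mul_apply]
  refine Finset.sum_eq_single i (fun l _ hl => ?_) (by simp)
  rcases lt_or_gt_of_ne hl with h | h
  · rw [hM h, zero_mul]
  · rw [hN h, mul_zero]

lemma upperTriangular_isUnit_det {k : ℕ} {M : Matrix (Fin k) (Fin k) ℝ}
    (hM : M.BlockTriangular id) (hpos : ∀ i, 0 < M i i) : IsUnit M.det := by
  rw [Matrix.det_of_isUpperTriangular hM]
  exact (Finset.prod_pos fun i _ => hpos i).ne'.isUnit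

lemma upperTriangular_inv {k : ℕ} {M : Matrix (Fin k) (Fin k) ℝ}
    (hM : M.BlockTriangular id) (hpos : ∀ i, 0 < M i i) : M⁻¹.BlockTriangular id :=
  have := Matrix.invertibleOfIsUnitDet M (upperTriangular_isUnit_det hM hpos)
  Matrix.blockTriangular_inv_of_blockTriangular hM

section Column

variable {d k : ℕ} {Q Qt F : Matrix (Fin d) (Fin k) ℝ} {S : Matrix (Fin k) (Fin k) ℝ} {y : ℝ}

lemma sum_sq_lt_le (hQ : Qᵀ * Q = 1) (hQt : Qtᵀ * Qt = 1) (hS : Qt * S = Q + F)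
    (hStri : S.BlockTriangular id) (hSpos : ∀ i, 0 < S i i) (hy0 : 0 ≤ y) (hy : y ≤ 1)
    (hF : ∀ c, (F *ᵥ c) ⬝ᵥ (F *ᵥ c) ≤ y ^ 2 * (c ⬝ᵥ c)) (j : Fin k) :
    ∑ i, (if i < j then (Qᵀ * Qt) j i else 0) ^ 2 ≤ y ^ 2 := by
  set w : Fin k → ℝ := fun i => if i < j then (Qᵀ * Qt) j i else 0 with hw
  have hdet : IsUnit S.det := upperTriangular_isUnit_det hStri hSpos
  have hT : S⁻¹.BlockTriangular id := upperTriangular_inv hStri hSpos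
  set c := S⁻¹ *ᵥ w with hc
  have hcj : c j = 0 := by
    rw [hc, Matrix.mulVec, dotProduct]
    refine Finset.sum_eq_zero fun i _ => ?_
    by_cases h : i < j
    · simp [hT h]
    · simp [hw, h]
  have hv : Qt *ᵥ w = Q *ᵥ c + F *ᵥ c := by
    rw [← Matrix.add_mulVec, ← hS, hc, Matrix.mulVec_mulVec, Matrix.mul_assoc,
      Matrix.mul_nonsing_inv _ hdet, Matrix.mul_one]
  have hww : w ⬝ᵥ w = ∑ i, w i ^ 2 := by simp [dotProduct, pow_two]
  have hMw : (Q *ᵥ Pi.single j 1) ⬝ᵥ (Qt *ᵥ w) = ∑ i, w i ^ 2 := by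
    rw [mulVec_dotProduct_mulVec, single_one_dotProduct, Matrix.mulVec, dotProduct]
    refine Finset.sum_congr rfl fun i _ => ?_
    by_cases h : i < j <;> simp [hw, h, pow_two]
  have h := sq_dotProduct_add_le (q := Q *ᵥ Pi.single j 1) (u := Q *ᵥ c) (g := F *ᵥ c) hy0 hy
    (by rw [mulVec_dotProduct_mulVec_of_orthonormal hQ]; simp)
    (by rw [mulVec_dotProduct_mulVec_of_orthonormal hQ]; simp [hcj])
    (by rw [mulVec_dotProduct_mulVec_of_orthonormal hQ]; exact hF c)
  rw [← hv, hMw, mulVec_dotProduct_mulVec_of_orthonormal hQt, hww] at h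
  have hb : 0 ≤ ∑ i, w i ^ 2 := Finset.sum_nonneg fun i _ => sq_nonneg _
  by_contra! hlt
  nlinarith [sq_nonneg y]

lemma diag_sq_add_le (hQ : Qᵀ * Q = 1) (hQt : Qtᵀ * Qt = 1) (hS : Qt * S = Q + F)
    (hStri : S.BlockTriangular id) (hSpos : ∀ i, 0 < S i i) (hy0 : 0 ≤ y) (hy : y ≤ 1)
    (hF : ∀ c, (F *ᵥ c) ⬝ᵥ (F *ᵥ c) ≤ y ^ 2 * (c ⬝ᵥ c)) (j : Fin k) :
    S j j ^ 2 + (1 - 2 * y ^ 2) ≤ 2 * S j j * (Qᵀ * Qt) j j := by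
  have hb := sum_sq_lt_le hQ hQt hS hStri hSpos hy0 hy hF j
  set e : Fin k → ℝ := Pi.single j 1 with he
  have hf := hF e
  have hFe : F *ᵥ e = Qt *ᵥ (S *ᵥ e) - Q *ᵥ e := by
    rw [Matrix.mulVec_mulVec, hS, Matrix.add_mulVec, add_sub_cancel_left]
  have hSe : S *ᵥ e = fun i => S i j := by ext i; simp [he]
  have hcross : (Q *ᵥ e) ⬝ᵥ (Qt *ᵥ (S *ᵥ e)) = ∑ i, (Qᵀ * Qt) j i * S i j := by
    rw [mulVec_dotProduct_mulVec, he, single_one_dotProduct, ← he, hSe]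
    rfl
  have hee : e ⬝ᵥ e = 1 := by simp [he]
  rw [hFe, sub_dotProduct, dotProduct_sub, dotProduct_sub, dotProduct_comm (Qt *ᵥ _) (Q *ᵥ e),
    hcross, mulVec_dotProduct_mulVec_of_orthonormal hQt,
    mulVec_dotProduct_mulVec_of_orthonormal hQ, hee, hSe] at hf
  have hpt : ∑ i, ((if i = j then S j j ^ 2 - 2 * ((Qᵀ * Qt) j j * S j j) else 0)
      - (if i < j then (Qᵀ * Qt) j i else 0) ^ 2)
      ≤ ∑ i, (S i j * S i j - 2 * ((Qᵀ * Qt) j i * S i j)) := by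
    refine Finset.sum_le_sum fun i _ => ?_
    rcases lt_trichotomy i j with h | h | h
    · simp only [h.ne, h, if_true, if_false]
      nlinarith [sq_nonneg (S i j - (Qᵀ * Qt) j i)]
    · subst h
      simp only [lt_irrefl, if_true, if_false]
      nlinarith
    · simp [h.ne', h.not_gt, hStri h]
  rw [Finset.sum_sub_distrib, Finset.sum_sub_distrib, ← Finset.mul_sum, Finset.sum_ite_eq' univ j,
    if_pos (Finset.mem_univ j)] at hpt
  have hd : (fun i => S i j) ⬝ᵥ (fun i => S i j) = ∑ i, S i j * S i j := rfl
  rw [hd] at hf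
  linarith

end Column

lemma neg_one_le_transpose_mul_apply {d k : ℕ} {Q Qt : Matrix (Fin d) (Fin k) ℝ}
    (hQ : Qᵀ * Q = 1) (hQt : Qtᵀ * Qt = 1) (j : Fin k) : -1 ≤ (Qᵀ * Qt) j j := by
  have h := sq_dotProduct_le (Q *ᵥ Pi.single j 1) (Qt *ᵥ Pi.single j 1)
  rw [mulVec_dotProduct_mulVec_of_orthonormal hQ, mulVec_dotProduct_mulVec_of_orthonormal hQt,
    mulVec_dotProduct_mulVec] at h
  simp only [single_one_dotProduct, Matrix.mulVec_single_one, Matrix.col_apply,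
    Pi.single_eq_same, mul_one] at h
  exact (abs_le.1 ((sq_le_one_iff_abs_le_one _).1 h)).1

lemma one_sub_sq_div_le {s m y : ℝ} (hs : 0 < s) (hy0 : 0 ≤ y) (hy1 : y < 1) (hm : -1 ≤ m)
    (h : s ^ 2 + (1 - 2 * y ^ 2) ≤ 2 * s * m) : 1 - (y / (1 - y)) ^ 2 ≤ m := by
  have hp : 0 < 1 - y := by linarith
  set z := y / (1 - y) with hz
  have hzy : z * (1 - y) = y := div_mul_cancel₀ _ hp.ne'
  have hz0 : 0 ≤ z := by positivity
  rcases le_total y (1 / 2) with h2 | h2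
  · have hz1 : z ≤ 1 := by rw [hz, div_le_one hp]; linarith
    have key : (1 - z ^ 2) ^ 2 ≤ 1 - 2 * y ^ 2 := by
      have hy : y = z / (1 + z) := by rw [eq_div_iff (by positivity)]; linarith
      have hyz : y ^ 2 * (1 + z) ^ 2 = z ^ 2 := by rw [hy]; field_simp
      have hz2 : 2 ≤ (1 + z) ^ 2 * (2 - z ^ 2) := by
        have : (1 + z) ^ 2 * (2 - z ^ 2)
          = 2 + (z * (1 - z) * (4 + 5 * z + 3 * z ^ 2) + 2 * z ^ 4) := by ring
        have h1z : 0 ≤ 1 - z := by linarith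
        have : 0 ≤ z * (1 - z) * (4 + 5 * z + 3 * z ^ 2) + 2 * z ^ 4 := by positivity
        linarith
      have : y ^ 2 * 2 ≤ y ^ 2 * ((1 + z) ^ 2 * (2 - z ^ 2)) := by gcongr
      have : y ^ 2 * ((1 + z) ^ 2 * (2 - z ^ 2)) = z ^ 2 * (2 - z ^ 2) := by
        rw [← mul_assoc, hyz]
      nlinarith
    have : 0 ≤ 2 * s * (m - (1 - z ^ 2)) := by nlinarith [sq_nonneg (s - (1 - z ^ 2))]
    have := nonneg_of_mul_nonneg_right this (by positivity)
    linarith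
  · rcases le_total (2 * y ^ 2) 1 with h3 | h3
    · have hz1 : 1 ≤ z := by rw [hz, le_div_iff₀ hp]; linarith
      have : 0 ≤ 2 * s * m := by nlinarith
      have := nonneg_of_mul_nonneg_right this (by positivity)
      nlinarith
    · have hz1 : 2 ≤ z := by rw [hz, le_div_iff₀ hp]; nlinarith
      nlinarith

/-- **QR factor perturbation.** Let `A ∈ ℝ^{d×k}` (`d ≥ k`) have full
column rank and QR factorization `A = Q R` (with `Q` having orthonormal columns and `R`
upper triangular with positive diagonal).  Let `E` be a perturbation with
`‖E‖₂ ‖A†‖₂ < 1`, and let `A + E = Q̃ R̃` be the QR factorization of `A + E`.  Then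
`‖Q̃ − Q‖₂ ≤ √(2k) · ‖A†‖₂ ‖E‖₂ / (1 − ‖A†‖₂ ‖E‖₂)`. -/
theorem qr_factor_perturbation {d k : ℕ} (hkd : k ≤ d)
    (A E : Matrix (Fin d) (Fin k) ℝ) (hA : A.rank = k)
    (Ap : Matrix (Fin k) (Fin d) ℝ) (hAp : IsMoorePenrose A Ap)
    (hpert : specNorm E * specNorm Ap < 1)
    (Q Qt : Matrix (Fin d) (Fin k) ℝ) (R Rt : Matrix (Fin k) (Fin k) ℝ)
    (hQ : Qᵀ * Q = 1) (hQt : Qtᵀ * Qt = 1)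
    (hRtri : ∀ i j : Fin k, j < i → R i j = 0) (hRpos : ∀ i, 0 < R i i)
    (hRttri : ∀ i j : Fin k, j < i → Rt i j = 0) (hRtpos : ∀ i, 0 < Rt i i)
    (hQR : A = Q * R) (hQRt : A + E = Qt * Rt) :
    specNorm (Qt - Q) ≤
      Real.sqrt (2 * k) * (specNorm Ap * specNorm E) /
        (1 - specNorm Ap * specNorm E) := by
  have hx0 : 0 ≤ specNorm Ap * specNorm E := mul_nonneg (specNorm_nonneg _) (specNorm_nonneg _)
  have hx1 : specNorm Ap * specNorm E < 1 := by rwa [mul_comm]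
  have hRtri' : R.BlockTriangular id := fun i j h => hRtri i j h
  have hRttri' : Rt.BlockTriangular id := fun i j h => hRttri i j h
  have hRinv : R * (Ap * Q) = 1 := by
    have h := hAp.1
    rw [hQR] at h
    have hdet : IsUnit R.det := upperTriangular_isUnit_det hRtri' hRpos
    have h1 : Qᵀ * (Q * R * Ap * (Q * R)) * R⁻¹ = Qᵀ * (Q * R) * R⁻¹ := by rw [h]
    simp only [Matrix.mul_assoc, Matrix.mul_nonsing_inv _ hdet, Matrix.mul_one] at h1
    simpa only [← Matrix.mul_assoc, hQ, Matrix.one_mul] using h1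
  have hinv : (Ap * Q).BlockTriangular id := by
    rw [← Matrix.inv_eq_right_inv hRinv]
    exact upperTriangular_inv hRtri' hRpos
  have hStri : (Rt * (Ap * Q)).BlockTriangular id := hRttri'.mul hinv
  have hSpos : ∀ i, 0 < (Rt * (Ap * Q)) i i := fun i => by
    rw [upperTriangular_mul_apply_self hRttri' hinv]
    have h := upperTriangular_mul_apply_self hRtri' hinv i
    rw [hRinv, Matrix.one_apply_eq] at h
    exact mul_pos (hRtpos i) (pos_of_mul_pos_right (h ▸ one_pos) (hRpos i).le)
  have hS : Qt * (Rt * (Ap * Q)) = Q + E * Ap * Q := by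
    rw [← Matrix.mul_assoc, ← hQRt, Matrix.add_mul, hQR, Matrix.mul_assoc Q, hRinv,
      Matrix.mul_one, Matrix.mul_assoc E]
  have hF : ∀ c, ((E * Ap * Q) *ᵥ c) ⬝ᵥ ((E * Ap * Q) *ᵥ c)
      ≤ (specNorm Ap * specNorm E) ^ 2 * (c ⬝ᵥ c) := fun c => by
    rw [← Matrix.mulVec_mulVec, ← Matrix.mulVec_mulVec]
    have h1 := mulVec_dotProduct_self_le E (Ap *ᵥ (Q *ᵥ c))
    have h2 := mulVec_dotProduct_self_le Ap (Q *ᵥ c)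
    rw [mulVec_dotProduct_mulVec_of_orthonormal hQ] at h2
    calc _ ≤ _ := h1
      _ ≤ specNorm E ^ 2 * (specNorm Ap ^ 2 * (c ⬝ᵥ c)) := by gcongr
      _ = _ := by ring
  have hdiag : ∀ j, 1 - (specNorm Ap * specNorm E / (1 - specNorm Ap * specNorm E)) ^ 2
      ≤ (Qᵀ * Qt) j j := fun j =>
    one_sub_sq_div_le (hSpos j) hx0 hx1 (neg_one_le_transpose_mul_apply hQ hQt j)
      (diag_sq_add_le hQ hQt hS hStri hSpos hx0 hx1.le hF j)
  have hx2 : 0 ≤ 1 - specNorm Ap * specNorm E := by linarith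
  rw [mul_div_assoc]
  refine specNorm_le_of_sum_sq_le _ (by positivity) ?_
  rw [mul_pow, Real.sq_sqrt (by positivity)]
  have hentry : ∀ j, ((Qt - Q)ᵀ * (Qt - Q)) j j
      ≤ 2 * (specNorm Ap * specNorm E / (1 - specNorm Ap * specNorm E)) ^ 2 := fun j => by
    have hsymm : (Qtᵀ * Q) j j = (Qᵀ * Qt) j j := by
      rw [← Matrix.transpose_apply (Qᵀ * Qt), Matrix.transpose_mul, Matrix.transpose_transpose]
    rw [Matrix.transpose_sub, Matrix.sub_mul, Matrix.mul_sub, Matrix.mul_sub, hQ, hQt]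
    simp only [Matrix.sub_apply, Matrix.one_apply_eq, hsymm]
    linarith [hdiag j]
  calc _ ≤ ∑ _j : Fin k, 2 * (specNorm Ap * specNorm E / (1 - specNorm Ap * specNorm E)) ^ 2 :=
        Finset.sum_le_sum fun j _ => hentry j
    _ = _ := by
        rw [Finset.sum_const, Finset.card_univ, Fintype.card_fin, nsmul_eq_mul]
        ring
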